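/- Let k be a field of characteristic zero, φ(T) ∈ k[T] with deg φ ≥ 2, and B = k[X,Y,Z]/(XY − φ(Z)) the coordinate ring of the corresponding special Danielewski surface. If B admits a nontrivial fundamental pair, then deg φ = 2 and B is isomorphic as a k-algebra to either k[F_2] or S_λ(k) for some λ ∈ k*. Moreover, for every λ ∈ k*, Q_λ(k) is not isomorphic to k[X,Y,Z]/(XY − ψ(Z)) for any nonconstant ψ ∈ k[T]. -/

import Mathlib

/-- A derivation is locally nilpotent if every element is annihilated by some power. -/
def IsLND {R B : Type*} [CommRing R] [CommRing B] [Algebra R B]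
    (D : Derivation R B B) : Prop :=
  ∀ b : B, ∃ n : ℕ, (D.toLinearMap ^ n) b = 0

/-- The degree-`d` piece `B_d = ker([D,U] - d·id)` of the `ℤ`-grading induced by `(D, U)`. -/
def gradePiece {R B : Type*} [CommRing R] [CommRing B] [Algebra R B]
    (D U : Derivation R B B) (d : ℤ) : Submodule R B :=
  LinearMap.ker ((⁅D, U⁆ : Derivation R B B).toLinearMap
    - d • (LinearMap.id : B →ₗ[R] B))

/-- `(D, U)` is a fundamental pair: both are locally nilpotent, `[D,[D,U]] = -2D`,
`[U,[D,U]] = 2U`, and `B` is the sum of the eigenspaces of `[D,U]`. -/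
def IsFundamentalPair {R B : Type*} [CommRing R] [CommRing B] [Algebra R B]
    (D U : Derivation R B B) : Prop :=
  IsLND D ∧ IsLND U ∧
    ⁅D, ⁅D, U⁆⁆ = (-2 : ℤ) • D ∧
    ⁅U, ⁅D, U⁆⁆ = (2 : ℤ) • U ∧
    (⨆ d : ℤ, gradePiece D U d) = ⊤

open MvPolynomial

set_option synthInstance.maxHeartbeats 1000000
set_option maxHeartbeats 1000000

/-- The ideal `(XY − φ(Z))` of `k[X,Y,Z]`. -/
noncomputable abbrev DanIdeal (k : Type*) [Field k] (phi : Polynomial k) :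
    Ideal (MvPolynomial (Fin 3) k) :=
  Ideal.span {X 0 * X 1 - Polynomial.aeval (X 2) phi}

/-- The coordinate ring `k[X,Y,Z]/(XY − φ(Z))` of a special Danielewski surface. -/
noncomputable abbrev Dan (k : Type*) [Field k] (phi : Polynomial k) :=
  MvPolynomial (Fin 3) k ⧸ DanIdeal k phi

/-- `k[F_2]`: the subalgebra of `k[y,z]` generated by `y², yz, z²`. -/
noncomputable def coneRNC2 (k : Type*) [Field k] : Subalgebra k (MvPolynomial (Fin 2) k) :=
  Algebra.adjoin k {X 0 ^ 2, X 0 * X 1, X 1 ^ 2}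

/-- The ideal `(2x₀x₂ − x₁² − λ)` of `k[x₀,x₁,x₂]`. -/
noncomputable abbrev SIdeal (k : Type*) [Field k] (lam : k) : Ideal (MvPolynomial (Fin 3) k) :=
  Ideal.span {2 * X 0 * X 2 - X 1 ^ 2 - C lam}

/-- The smooth Danielewski surface ring `S_λ(k) = k[x₀,x₁,x₂]/(2x₀x₂ − x₁² − λ)`. -/
noncomputable abbrev Slam (k : Type*) [Field k] (lam : k) :=
  MvPolynomial (Fin 3) k ⧸ SIdeal k lam

/-- `Q_λ(k)`: the subalgebra of `S_λ(k)` generated by the images of the quadratic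
monomials (equivalently of `x₂², x₁x₂, 3x₀x₂ − λ, x₀x₁, x₀²`). -/
noncomputable def Qlam (k : Type*) [Field k] (lam : k) : Subalgebra k (Slam k lam) :=
  Algebra.adjoin k
    {Ideal.Quotient.mk (SIdeal k lam) (X 2 ^ 2),
     Ideal.Quotient.mk (SIdeal k lam) (X 1 * X 2),
     Ideal.Quotient.mk (SIdeal k lam) (3 * X 0 * X 2 - C lam),
     Ideal.Quotient.mk (SIdeal k lam) (X 0 * X 1),
     Ideal.Quotient.mk (SIdeal k lam) (X 0 ^ 2)}

section LaurentModel

variable {k : Type*} [Field k]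

/-- The Laurent polynomial ring `k[z][x, x⁻¹]`, in which every `k[X,Y,Z]/(XY − φ(Z))` embeds. -/
abbrev Lau (k : Type*) [Field k] := AddMonoidAlgebra (Polynomial k) ℤ

namespace Lau

/-- The monomial `p(z) xⁿ`. -/
noncomputable def mono (n : ℤ) (p : Polynomial k) : Lau k := AddMonoidAlgebra.single n p

@[simp] lemma coeff_mono (n m : ℤ) (p : Polynomial k) :
    (mono n p).coeff m = if n = m then p else 0 := by
  rw [mono, AddMonoidAlgebra.coeff_single, Finsupp.single_apply]

lemma mono_add (n : ℤ) (p q : Polynomial k) : mono n (p + q) = mono n p + mono n q :=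
  AddMonoidAlgebra.single_add _ _ _

@[simp] lemma mono_zero (n : ℤ) : mono n (0 : Polynomial k) = 0 :=
  AddMonoidAlgebra.single_zero _

lemma mono_neg (n : ℤ) (p : Polynomial k) : mono n (-p) = -mono n p := by
  rw [eq_neg_iff_add_eq_zero, ← mono_add, neg_add_cancel, mono_zero]

lemma mono_mul_mono (m n : ℤ) (p q : Polynomial k) :
    mono m p * mono n q = mono (m + n) (p * q) :=
  AddMonoidAlgebra.single_mul_single _ _ _ _

lemma mono_zero_one : mono 0 (1 : Polynomial k) = 1 := rfl

lemma mono_zero_C (c : k) : mono 0 (Polynomial.C c) = algebraMap k (Lau k) c := rfl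

lemma sum_mono (F : Lau k) : F.coeff.sum mono = F := AddMonoidAlgebra.sum_coeff_single F

lemma coeff_mono_mul (n m : ℤ) (p : Polynomial k) (F : Lau k) :
    (mono n p * F).coeff m = p * F.coeff (-n + m) :=
  AddMonoidAlgebra.coeff_single_mul_apply _ _ _ _

lemma induction {motive : Lau k → Prop} (F : Lau k) (zero : motive 0)
    (add : ∀ F G, motive F → motive G → motive (F + G))
    (mono : ∀ n p, motive (mono n p)) : motive F :=
  AddMonoidAlgebra.induction_linear F zero add mono

/-- Apply a linear map to each coefficient. -/
noncomputable def coeffMap (g : ℤ → Polynomial k →ₗ[k] Polynomial k) : Lau k →ₗ[k] Lau k where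
  toFun F := .ofCoeff (Finsupp.onFinset F.coeff.support (fun n => g n (F.coeff n)) (by
    intro n hn
    rw [Finsupp.mem_support_iff]
    rintro h
    simp [h] at hn))
  map_add' F G := by ext n : 2; simp
  map_smul' c F := by ext n : 2; simp

@[simp] lemma coeff_coeffMap (g : ℤ → Polynomial k →ₗ[k] Polynomial k) (F : Lau k) (n : ℤ) :
    (coeffMap g F).coeff n = g n (F.coeff n) := rfl

@[simp] lemma coeffMap_mono (g : ℤ → Polynomial k →ₗ[k] Polynomial k) (n : ℤ)
    (p : Polynomial k) : coeffMap g (mono n p) = mono n (g n p) := by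
  ext m : 2
  rw [coeff_coeffMap]
  by_cases h : n = m
  · subst h; simp
  · simp [h]

/-- A coefficientwise map satisfying the Leibniz rule on monomials is a derivation. -/
noncomputable def coeffDer (g : ℤ → Polynomial k →ₗ[k] Polynomial k)
    (hg : ∀ m n p q, g (m + n) (p * q) = p * g n q + q * g m p) :
    Derivation k (Lau k) (Lau k) :=
  Derivation.mk' (coeffMap g) (by
    intro F G
    induction F using Lau.induction with
    | zero => simp
    | add F F' h h' => simp only [add_mul, map_add, h, h', smul_eq_mul]; ring
    | mono m p =>
      induction G using Lau.induction with
      | zero => simp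
      | add G G' h h' => simp only [mul_add, map_add, h, h', smul_eq_mul]; ring
      | mono n q =>
        simp only [smul_eq_mul, mono_mul_mono, coeffMap_mono, hg]
        rw [add_comm n m, ← mono_add])

/-- The derivation `∂/∂z`. -/
noncomputable def dz : Derivation k (Lau k) (Lau k) :=
  coeffDer (fun _ => Polynomial.derivative) (by
    intro m n p q; simp [Polynomial.derivative_mul]; ring)

/-- The Euler derivation `x ∂/∂x`. -/
noncomputable def th : Derivation k (Lau k) (Lau k) :=
  coeffDer (fun n => n • LinearMap.id) (by
    intro m n p q; simp; ring)

@[simp] lemma coeff_dz (F : Lau k) (n : ℤ) :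
    (dz F).coeff n = Polynomial.derivative (F.coeff n) := rfl

@[simp] lemma coeff_th (F : Lau k) (n : ℤ) : (th F).coeff n = n * F.coeff n := by
  rw [← zsmul_eq_mul]; rfl

lemma dz_th (F : Lau k) : dz (th F) = th (dz F) := by
  ext n : 2
  simp [Polynomial.derivative_mul]

lemma dz_mono (n : ℤ) (p : Polynomial k) :
    dz (mono n p) = mono n (Polynomial.derivative p) := coeffMap_mono _ _ _

lemma th_mono (n : ℤ) (p : Polynomial k) :
    th (mono n p) = mono n ((n : Polynomial k) * p) := by
  rw [← zsmul_eq_mul]; exact coeffMap_mono _ _ _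

/-- The Poisson bracket with `{z, x} = x`. -/
noncomputable def br (F G : Lau k) : Lau k := dz F * th G - th F * dz G

/-- `{F, ·}` as a derivation. -/
noncomputable def ad (F : Lau k) : Derivation k (Lau k) (Lau k) := dz F • th - th F • dz

lemma ad_apply (F G : Lau k) : ad F G = br F G := rfl

lemma br_skew (F G : Lau k) : br F G = -br G F := by simp only [br]; ring

lemma br_self (F : Lau k) : br F F = 0 := by simp only [br]; ring

lemma br_jacobi (F G H : Lau k) : br F (br G H) - br G (br F H) = br (br F G) H := by
  simp only [br, map_sub, Derivation.leibniz, smul_eq_mul, dz_th]; ring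

lemma br_plucker (a b c d : Lau k) :
    br a b * br c d - br a c * br b d + br a d * br b c = 0 := by
  simp only [br]; ring

lemma br_mul_right (a b c : Lau k) : br a (b * c) = b * br a c + c * br a b := by
  simp only [br, Derivation.leibniz, smul_eq_mul]; ring

/-- The coordinate `x`. -/
noncomputable abbrev x : Lau k := mono 1 1
/-- The coordinate `z`. -/
noncomputable abbrev z : Lau k := mono 0 Polynomial.X
/-- The element `y = φ(z) / x`. -/
noncomputable abbrev y (phi : Polynomial k) : Lau k := mono (-1) phi

lemma dz_x : dz (x : Lau k) = 0 := by simp [dz_mono]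
lemma dz_z : dz (z : Lau k) = 1 := by simp [dz_mono, mono_zero_one]
lemma dz_y (phi : Polynomial k) : dz (y phi) = y (Polynomial.derivative phi) := dz_mono _ _
lemma th_x : th (x : Lau k) = x := by simp [th_mono]
lemma th_z : th (z : Lau k) = 0 := by simp [th_mono]
lemma th_y (phi : Polynomial k) : th (y phi) = -y phi := by simp [th_mono, mono_neg]

lemma br_z (F : Lau k) : br z F = th F := by simp [br, dz_z, th_z]
lemma br_x (F : Lau k) : br x F = -(x * dz F) := by simp [br, dz_x, th_x]

/-- `x⁻¹`. -/
noncomputable abbrev xinv : Lau k := mono (-1) 1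

lemma xinv_mul_x : (xinv : Lau k) * x = 1 := by
  rw [mono_mul_mono]; simp [mono_zero_one]

lemma x_ne_zero : (x : Lau k) ≠ 0 := fun h => by
  have := xinv_mul_x (k := k)
  rw [h, mul_zero] at this
  exact zero_ne_one this

/-- The subalgebra of `k[z][x, x⁻¹]` consisting of the `∑ pᵢ(z) xⁱ` with `φⁿ ∣ p₋ₙ`. -/
noncomputable def M (phi : Polynomial k) : Subalgebra k (Lau k) where
  carrier := {F | ∀ n : ℤ, phi ^ (-n).toNat ∣ F.coeff n}
  add_mem' {F G} hF hG n := by simpa using dvd_add (hF n) (hG n)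
  algebraMap_mem' c n := by
    rw [← mono_zero_C, coeff_mono]
    split_ifs with h
    · subst h; simp
    · simp
  mul_mem' {F G} hF hG n := by
    rw [← sum_mono F, Finsupp.sum_mul, Finsupp.sum,
      AddMonoidAlgebra.coeff_sum, Finsupp.finsetSum_apply]
    refine Finset.dvd_sum fun i _ => ?_
    rw [coeff_mono_mul]
    refine (pow_dvd_pow phi ?_).trans ((pow_add phi _ _).dvd.trans (mul_dvd_mul (hF i) (hG _)))
    omega

lemma mono_mem_M {phi : Polynomial k} {n : ℤ} {p : Polynomial k}
    (h : phi ^ (-n).toNat ∣ p) : mono n p ∈ M phi := by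
  intro m
  rw [coeff_mono]
  split_ifs with hm
  · subst hm; exact h
  · simp

lemma x_mem (phi : Polynomial k) : x ∈ M phi := mono_mem_M (by simp)
lemma z_mem (phi : Polynomial k) : z ∈ M phi := mono_mem_M (by simp)
lemma y_mem (phi : Polynomial k) : y phi ∈ M phi := mono_mem_M (by simp)

lemma mono_pow (n : ℤ) (p : Polynomial k) (a : ℕ) : mono n p ^ a = mono (a * n) (p ^ a) := by
  induction a with
  | zero => simp [mono_zero_one]
  | succ a ih => rw [pow_succ, ih, mono_mul_mono, pow_succ]; congr 1; push_cast; ring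

lemma aeval_z (p : Polynomial k) : Polynomial.aeval (z : Lau k) p = mono 0 p := by
  induction p using Polynomial.induction_on' with
  | add p q hp hq => rw [map_add, hp, hq, mono_add]
  | monomial n c =>
    rw [Polynomial.aeval_monomial, mono_pow, ← mono_zero_C, mono_mul_mono,
      Polynomial.C_mul_X_pow_eq_monomial]
    simp

lemma x_mul_y (phi : Polynomial k) : x * y phi = Polynomial.aeval (z : Lau k) phi := by
  rw [aeval_z, mono_mul_mono]; simp

lemma M_le_adjoin (phi : Polynomial k) : M phi ≤ Algebra.adjoin k {x, y phi, z} := by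
  intro F hF
  rw [← sum_mono F]
  refine Subalgebra.sum_mem _ fun n _ => ?_
  have hx : (x : Lau k) ∈ Algebra.adjoin k {x, y phi, z} := Algebra.subset_adjoin (by simp)
  have hy : (y phi : Lau k) ∈ Algebra.adjoin k {x, y phi, z} := Algebra.subset_adjoin (by simp)
  have hz : (z : Lau k) ∈ Algebra.adjoin k {x, y phi, z} := Algebra.subset_adjoin (by simp)
  have hp (p : Polynomial k) : mono 0 p ∈ Algebra.adjoin k {x, y phi, z} := by
    rw [← aeval_z]
    exact Algebra.adjoin_mono (Set.singleton_subset_iff.2 (by simp))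
      (Polynomial.aeval_mem_adjoin_singleton k z)
  obtain ⟨r, hr⟩ := hF n
  rw [hr]
  rcases le_total 0 n with h | h
  · obtain ⟨a, rfl⟩ := Int.eq_ofNat_of_zero_le h
    have : mono (a : ℤ) (phi ^ (-(a : ℤ)).toNat * r) = mono 0 r * x ^ a := by
      rw [mono_pow, mono_mul_mono]; simp
    rw [this]
    exact mul_mem (hp r) (pow_mem hx a)
  · obtain ⟨a, ha⟩ := Int.eq_ofNat_of_zero_le (neg_nonneg.2 h)
    have : mono n (phi ^ (-n).toNat * r) = mono 0 r * y phi ^ a := by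
      rw [mono_pow, mono_mul_mono, ha, mul_comm]
      congr 1
      omega
    rw [this]
    exact mul_mem (hp r) (pow_mem hy a)

lemma M_eq_adjoin (phi : Polynomial k) : M phi = Algebra.adjoin k {x, y phi, z} := by
  refine le_antisymm (M_le_adjoin phi) (Algebra.adjoin_le ?_)
  rintro F (rfl | rfl | rfl)
  exacts [x_mem _, y_mem _, z_mem _]

/-- A derivation maps an adjoined subalgebra into a subalgebra `S` if it does so on generators. -/
lemma _root_.Derivation.mem_of_mem_adjoin {A : Type*} [CommRing A] [Algebra k A]
    (D : Derivation k A A) (s : Set A) (S : Subalgebra k A) (hs : s ⊆ S)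
    (h : ∀ a ∈ s, D a ∈ S) {a : A} (ha : a ∈ Algebra.adjoin k s) : D a ∈ S := by
  induction ha using Algebra.adjoin_induction with
  | mem a ha => exact h a ha
  | algebraMap r => simp
  | add a b _ _ ha hb => rw [map_add]; exact add_mem ha hb
  | mul a b ha' hb' ha hb =>
    rw [Derivation.leibniz]
    exact add_mem (mul_mem (Algebra.adjoin_le hs ha') hb) (mul_mem (Algebra.adjoin_le hs hb') ha)

lemma br_mem {phi : Polynomial k} {F G : Lau k} (hF : F ∈ M phi) (hG : G ∈ M phi) :
    br F G ∈ M phi := by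
  have hs : {x, y phi, z} ⊆ (M phi : Set (Lau k)) := by
    rintro F (rfl | rfl | rfl)
    exacts [x_mem _, y_mem _, z_mem _]
  have hxy : br x (y phi) ∈ M phi := by
    rw [br_x, dz_y, mono_mul_mono, ← mono_neg]
    exact mono_mem_M (by simp)
  have key (F : Lau k) (h : ∀ a ∈ ({x, y phi, z} : Set (Lau k)), br F a ∈ M phi) {G : Lau k}
      (hG : G ∈ M phi) : br F G ∈ M phi := by
    rw [M_eq_adjoin] at hG
    exact (ad F).mem_of_mem_adjoin _ _ hs h hG
  refine key F (fun a ha => ?_) hG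
  rw [br_skew]
  refine neg_mem (key a (fun b hb => ?_) hF)
  have hz (F : Lau k) (hF : F ∈ ({x, y phi, z} : Set (Lau k))) : br z F ∈ M phi := by
    rw [br_z]
    rcases hF with (rfl | rfl | rfl)
    · rw [th_x]; exact x_mem _
    · rw [th_y]; exact neg_mem (y_mem _)
    · rw [th_z]; exact zero_mem _
  rcases hb with (rfl | rfl | rfl)
  · rcases ha with (rfl | rfl | rfl)
    · rw [br_self]; exact zero_mem _
    · rw [br_skew]; exact neg_mem hxy
    · exact hz _ (by simp)
  · rcases ha with (rfl | rfl | rfl)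
    · exact hxy
    · rw [br_self]; exact zero_mem _
    · exact hz _ (by simp)
  · rw [br_skew]
    exact neg_mem (hz _ ha)

lemma leading_term {A : Type*} [CommRing A] [Algebra k A] (D : Derivation k A A) (m n : ℕ) :
    ∃ c : ℕ, 0 < c ∧ ∀ f g : A, D^[m + 1] f = 0 → D^[n + 1] g = 0 →
      D^[m + n] (f * g) = c * (D^[m] f * D^[n] g) := by
  induction m generalizing n with
  | zero =>
    refine ⟨1, one_pos, fun f g hf _ => ?_⟩
    simp only [zero_add, Function.iterate_one, Function.iterate_zero, id] at hf ⊢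
    have (n : ℕ) : D^[n] (f * g) = f * D^[n] g := by
      induction n with
      | zero => simp
      | succ n ih => simp [Function.iterate_succ_apply', ih, hf]
    simp [this]
  | succ m ihm =>
    induction n with
    | zero =>
      refine ⟨1, one_pos, fun f g _ hg => ?_⟩
      simp only [add_zero, zero_add, Function.iterate_one, Function.iterate_zero, id] at hg ⊢
      have (n : ℕ) : D^[n] (f * g) = D^[n] f * g := by
        induction n with
        | zero => simp
        | succ n ih => simp [Function.iterate_succ_apply', ih, hg, mul_comm]
      simp [this]
    | succ n ihn =>
      obtain ⟨c, hc, h⟩ := ihm (n + 1)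
      obtain ⟨d, hd, h'⟩ := ihn
      refine ⟨c + d, by positivity, fun f g hf hg => ?_⟩
      rw [show m + 1 + (n + 1) = (m + (n + 1)) + 1 by ring, Function.iterate_succ_apply,
        D.leibniz, iterate_map_add, smul_eq_mul, smul_eq_mul, mul_comm g,
        h (D f) g (by rwa [← Function.iterate_succ_apply]) hg,
        show m + (n + 1) = m + 1 + n by ring,
        h' f (D g) hf (by rwa [← Function.iterate_succ_apply])]
      simp only [← Function.iterate_succ_apply]
      push_cast; ring

lemma exists_last_iterate {A : Type*} [Zero A] (D : A → A) {f : A} (hf : f ≠ 0)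
    (h : ∃ n, D^[n] f = 0) : ∃ n, D^[n] f ≠ 0 ∧ D^[n + 1] f = 0 := by
  classical
  obtain ⟨n, hn⟩ : ∃ n, Nat.find h = n + 1 :=
    Nat.exists_eq_succ_of_ne_zero fun h0 => hf (by simpa [h0] using Nat.find_spec h)
  exact ⟨n, Nat.find_min h (by omega), hn ▸ Nat.find_spec h⟩

lemma eq_zero_of_mul_eq_deriv [CharZero k] {A : Type*} [CommRing A] [IsDomain A] [Algebra k A]
    (D : Derivation k A A) {v d : A} (hv : v ≠ 0) (hvn : ∃ n, D^[n] v = 0)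
    (hdn : ∃ n, D^[n] d = 0) (h : D v = d * v) : d = 0 := by
  by_contra hd
  obtain ⟨n, hn, hn'⟩ := exists_last_iterate D hv hvn
  obtain ⟨m, hm, hm'⟩ := exists_last_iterate D hd hdn
  obtain ⟨c, hc, hmn⟩ := leading_term D m n
  have := hmn d v hm' hn'
  have h0 : D^[m + n] (D v) = 0 := by
    rw [← Function.iterate_succ_apply, show (m + n).succ = m + (n + 1) by omega,
      Function.iterate_add_apply, hn', iterate_map_zero]
  rw [← h, h0] at this
  have hA : CharZero A := charZero_of_injective_algebraMap (algebraMap k A).injective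
  rcases mul_eq_zero.1 this.symm with h | h
  · exact hc.ne' (Nat.cast_eq_zero.1 h)
  · exact mul_ne_zero hm hn h

section twisted

variable (D : Derivation k (Lau k) (Lau k)) (d : Lau k)

/-- If `D` scales the bracket by `d`, this is the action of `D` on multiples of the bracket. -/
noncomputable def twist (w : Lau k) : Lau k := D w + d * w

lemma twist_nilpotent (hd : ∀ F G, D (br F G) = br (D F) G + br F (D G) + d * br F G)
    {F G : Lau k} (hF : ∃ n, D^[n] F = 0) (hG : ∃ n, D^[n] G = 0)
    (hFG : ∀ i j, ∃ n, D^[n] (br (D^[i] F) (D^[j] G)) = 0) :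
    ∃ N, (twist D d)^[N] 1 * br F G = 0 := by
  obtain ⟨a, ha⟩ := hF
  obtain ⟨b, hb⟩ := hG
  choose c hc using hFG
  obtain ⟨C, hC⟩ : ∃ C, ∀ i < a, ∀ j < b, c i j ≤ C :=
    ⟨∑ i ∈ Finset.range a, ∑ j ∈ Finset.range b, c i j, fun i hi j hj =>
      (Finset.single_le_sum (f := fun j => c i j) (fun _ _ => Nat.zero_le _)
        (Finset.mem_range.2 hj)).trans
      (Finset.single_le_sum (f := fun i => ∑ j ∈ Finset.range b, c i j)
        (fun _ _ => Nat.zero_le _) (Finset.mem_range.2 hi))⟩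
  have hmono {f : Lau k} {m n : ℕ} (hmn : m ≤ n) (h : D^[m] f = 0) : D^[n] f = 0 := by
    rw [← Nat.sub_add_cancel hmn, Function.iterate_add_apply, h, iterate_map_zero]
  have main (n : ℕ) : ∀ e i j, a + b + C ≤ e + i + j + n →
      D^[e] ((twist D d)^[n] 1 * br (D^[i] F) (D^[j] G)) = 0 := by
    induction n with
    | zero =>
      intro e i j h
      rw [Function.iterate_zero, id, one_mul]
      by_cases hi : a ≤ i
      · rw [hmono hi ha]; simp [br]
      by_cases hj : b ≤ j
      · rw [hmono hj hb]; simp [br]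
      have := hC i (by omega) j (by omega)
      exact hmono (by omega) (hc i j)
    | succ n ih =>
      intro e i j h
      have h1 := ih (e + 1) i j (by omega)
      have h2 := ih e (i + 1) j (by omega)
      have h3 := ih e i (j + 1) (by omega)
      set w := (twist D d)^[n] 1
      have : (twist D d)^[n + 1] 1 * br (D^[i] F) (D^[j] G) =
          D (w * br (D^[i] F) (D^[j] G)) - w * br (D^[i + 1] F) (D^[j] G)
            - w * br (D^[i] F) (D^[j + 1] G) := by
        simp only [Function.iterate_succ_apply', D.leibniz, hd, smul_eq_mul]
        change twist D d w * _ = _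
        rw [twist]; ring
      rw [this, iterate_map_sub, iterate_map_sub, ← Function.iterate_succ_apply, h1, h2, h3]
      simp
  exact ⟨a + b + C, by simpa using main (a + b + C) 0 0 0 (by omega)⟩

/-- A locally nilpotent derivation has divergence zero. -/
lemma divergence_eq_zero [CharZero k] {phi : Polynomial k} (hphi : phi ≠ 0)
    (hd : ∀ F G, D (br F G) = br (D F) G + br F (D G) + d * br F G)
    (hM : ∀ F ∈ M phi, D F ∈ M phi) (hnil : ∀ F ∈ M phi, ∃ n, D^[n] F = 0) : d = 0 := by
  have hit (n : ℕ) : ∀ F ∈ M phi, D^[n] F ∈ M phi := by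
    induction n with
    | zero => exact fun F h => h
    | succ n ih => exact fun F h => ih _ (hM F h)
  have hdM : d ∈ M phi := by
    have h1 (F : Lau k) (hF : F ∈ M phi) : d * br z F ∈ M phi := by
      have := hd z F
      rw [← sub_eq_iff_eq_add'] at this
      rw [← this]
      exact sub_mem (hM _ (br_mem (z_mem _) hF)) (add_mem (br_mem (hM _ (z_mem _)) hF)
        (br_mem (z_mem _) (hM _ hF)))
    have hx := h1 x (x_mem _)
    have hy := h1 (y phi) (y_mem _)
    rw [br_z, th_x, mul_comm] at hx
    have hneg : d * -y phi = -(y phi * d) := by ring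
    rw [br_z, th_y, hneg, neg_mem_iff] at hy
    intro n
    rcases le_or_gt 0 n with hn | hn
    · rw [show (-n).toNat = 0 by omega]; simp
    · have := hy (n - 1)
      rw [coeff_mono_mul, show (-(n - 1)).toNat = (-n).toNat + 1 by omega, pow_succ',
        mul_dvd_mul_iff_left hphi] at this
      convert this using 2
      ring
  obtain ⟨N, hN⟩ := twist_nilpotent D d hd (hnil _ (z_mem _)) (hnil _ (x_mem _))
    (fun i j => hnil _ (br_mem (hit i _ (z_mem _)) (hit j _ (x_mem _))))
  rw [br_z, th_x, mul_eq_zero, or_iff_left x_ne_zero] at hN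
  obtain ⟨n, hn, hn'⟩ := exists_last_iterate (twist D d) one_ne_zero ⟨N, hN⟩
  have hv (n : ℕ) : (twist D d)^[n] 1 ∈ M phi := by
    induction n with
    | zero => exact one_mem _
    | succ n ih =>
      rw [Function.iterate_succ_apply']
      exact add_mem (hM _ ih) (mul_mem hdM ih)
  rw [Function.iterate_succ_apply', twist] at hn'
  exact neg_eq_zero.1 (eq_zero_of_mul_eq_deriv D hn (hnil _ (hv n)) (hnil _ (neg_mem hdM))
    (by linear_combination hn'))

end twisted

lemma exists_antiderivative [CharZero k] (p : Polynomial k) :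
    ∃ q, Polynomial.derivative q = p := by
  induction p using Polynomial.induction_on' with
  | add p q hp hq =>
    obtain ⟨a, rfl⟩ := hp
    obtain ⟨b, rfl⟩ := hq
    exact ⟨a + b, by simp⟩
  | monomial n c =>
    refine ⟨Polynomial.monomial (n + 1) (c / (n + 1)), ?_⟩
    rw [Polynomial.derivative_monomial]
    have : (n : k) + 1 ≠ 0 := by exact_mod_cast n.succ_ne_zero
    simp [this]

/-- A locally nilpotent derivation of `k[X,Y,Z]/(XY − φ(Z))` is Hamiltonian. -/
theorem exists_hamiltonian [CharZero k] {phi : Polynomial k} (hphi : 1 ≤ phi.natDegree)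
    (a b : Lau k) (hM : ∀ F ∈ M phi, (a • dz + b • th : Derivation k _ _) F ∈ M phi)
    (hnil : ∀ F ∈ M phi, ∃ n, (a • dz + b • th : Derivation k _ _)^[n] F = 0) :
    ∃ h ∈ M phi, ∀ F, (a • dz + b • th : Derivation k _ _) F = br h F := by
  have hphi0 : phi ≠ 0 := by rintro rfl; simp at hphi
  have hdiv : dz a + th b = 0 := by
    rw [← neg_eq_zero]
    refine divergence_eq_zero (a • dz + b • th) _ hphi0 (fun F G => ?_) hM hnil
    simp only [br, Derivation.add_apply, Derivation.smul_apply, smul_eq_mul, map_sub, map_add,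
      Derivation.leibniz, dz_th]
    ring
  have hdivn (n : ℤ) : Polynomial.derivative (a.coeff n) + n * b.coeff n = 0 := by
    have := congrArg (fun F : Lau k => F.coeff n) hdiv
    simpa using this
  have ha : a ∈ M phi := by
    have := hM z (z_mem _)
    simpa [dz_z, th_z] using this
  have ha0 : a.coeff 0 = 0 := by
    have h1 := hM (y phi) (y_mem _) (-1)
    have h0 := hdivn 0
    rw [Int.cast_zero, zero_mul, add_zero] at h0
    obtain ⟨c, hc⟩ : ∃ c, a.coeff 0 = Polynomial.C c :=
      ⟨_, Polynomial.eq_C_of_natDegree_eq_zero (Polynomial.derivative_eq_zero.1 h0)⟩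
    have hy : (a • dz + b • th : Derivation k _ _) (y phi) =
        y (Polynomial.derivative phi) * a - y phi * b := by
      simp only [Derivation.add_apply, Derivation.smul_apply, smul_eq_mul, dz_y, th_y]; ring
    rw [hy, AddMonoidAlgebra.coeff_sub, Finsupp.sub_apply, coeff_mono_mul, coeff_mono_mul] at h1
    simp only [neg_neg, Int.toNat_one, pow_one] at h1
    rw [dvd_sub_left (dvd_mul_right _ _)] at h1
    norm_num at h1
    rw [hc] at h1 ⊢
    by_contra hne
    have hc0 : c ≠ 0 := fun h => hne (by simp [h])
    rw [((Polynomial.isUnit_C.2 hc0.isUnit)).dvd_mul_right] at h1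
    have hd0 : Polynomial.derivative phi ≠ 0 := fun h => by
      have := Polynomial.derivative_eq_zero.1 h
      omega
    have := Polynomial.natDegree_le_of_dvd h1 hd0
    have := Polynomial.natDegree_derivative_lt (p := phi) (by omega)
    omega
  obtain ⟨q, hq⟩ := exists_antiderivative (b.coeff 0)
  set h : Lau k := coeffMap (fun n => (-(n : k)⁻¹) • LinearMap.id) a + mono 0 q with hh
  have hcoeff (n : ℤ) : h.coeff n = (-(n : k)⁻¹) • a.coeff n + if 0 = n then q else 0 := by
    simp [hh]
  have hsmul (n : ℤ) (p : Polynomial k) : (n : Polynomial k) * p = (n : k) • p := by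
    rw [Polynomial.smul_eq_C_mul]; simp
  have hdz : dz h = b := by
    ext n : 2
    rw [coeff_dz, hcoeff]
    by_cases hn : n = 0
    · subst hn; simp [hq]
    · have hn' : (n : k) ≠ 0 := by exact_mod_cast hn
      have := hdivn n
      rw [add_eq_zero_iff_eq_neg, hsmul] at this
      rw [if_neg (Ne.symm hn), add_zero, Polynomial.derivative_smul, this, smul_neg, neg_smul,
        neg_neg, smul_smul, inv_mul_cancel₀ hn', one_smul]
  have hth : th h = -a := by
    ext n : 2
    rw [coeff_th, hcoeff]
    by_cases hn : n = 0
    · subst hn; simp [ha0]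
    · have hn' : (n : k) ≠ 0 := by exact_mod_cast hn
      rw [if_neg (Ne.symm hn), add_zero, hsmul, smul_smul, mul_neg, mul_inv_cancel₀ hn']
      simp
  refine ⟨h, fun n => ?_, fun F => ?_⟩
  · rw [hcoeff]
    refine dvd_add ?_ ?_
    · rw [Polynomial.smul_eq_C_mul]
      exact Dvd.dvd.mul_left (ha n) _
    · split_ifs with hn
      · subst hn; simp
      · simp
  · simp only [br, hdz, hth, Derivation.add_apply, Derivation.smul_apply, smul_eq_mul]; ring

lemma eq_const_of_casimir [CharZero k] {F : Lau k} (hz : dz F = 0) (ht : th F = 0) :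
    ∃ c, F = algebraMap k (Lau k) c := by
  have h0 : Polynomial.derivative (F.coeff 0) = 0 := by rw [← coeff_dz, hz]; rfl
  refine ⟨(F.coeff 0).coeff 0, ?_⟩
  rw [← mono_zero_C, ← Polynomial.eq_C_of_natDegree_eq_zero
    (Polynomial.derivative_eq_zero.1 h0)]
  refine LaurentPolynomial.ext fun n => ?_
  rw [coeff_mono]
  split_ifs with hn
  · rw [hn]
  · have : (th F).coeff n = 0 := by rw [ht]; rfl
    rw [coeff_th, mul_eq_zero, or_iff_right (by exact_mod_cast Ne.symm hn)] at this
    exact this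

lemma dvd_coeff_mul {phi : Polynomial k} {F G : Lau k} (hF : F ∈ M phi) (hG : G ∈ M phi)
    (h0 : F.coeff 0 = 0) : phi ∣ (F * G).coeff 0 := by
  rw [← sum_mono F, Finsupp.sum_mul, Finsupp.sum, AddMonoidAlgebra.coeff_sum,
    Finsupp.finsetSum_apply]
  refine Finset.dvd_sum fun n hn => ?_
  rw [coeff_mono_mul, add_zero]
  rcases lt_trichotomy n 0 with h | h | h
  · exact Dvd.dvd.mul_right ((dvd_pow_self phi (by omega)).trans (hF n)) _
  · subst h; exact absurd h0 (Finsupp.mem_support_iff.1 hn)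
  · exact Dvd.dvd.mul_left ((dvd_pow_self phi (by omega)).trans (hG (-n))) _

lemma coeff_zero_br {phi : Polynomial k} {F G : Lau k} (hF : F ∈ M phi) (hG : G ∈ M phi) :
    ∃ r, (br F G).coeff 0 = Polynomial.derivative (phi * r) := by
  obtain ⟨r, hr⟩ := dvd_coeff_mul (F := th F) (by rw [← br_z]; exact br_mem (z_mem _) hF) hG
    (by simp)
  refine ⟨-r, ?_⟩
  have : br F G = th (dz F * G) - dz (th F * G) := by
    simp only [br, Derivation.leibniz, smul_eq_mul, dz_th]; ring
  rw [this, AddMonoidAlgebra.coeff_sub, Finsupp.sub_apply, coeff_th, coeff_dz, hr]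
  simp

end Lau

end LaurentModel

section DanModel

variable {k : Type*} [Field k]

namespace Dan

open Lau

/-- The class of the `i`-th coordinate. -/
noncomputable abbrev coord (phi : Polynomial k) (i : Fin 3) : Dan k phi :=
  Ideal.Quotient.mk (DanIdeal k phi) (X i)

lemma coord_rel (phi : Polynomial k) :
    coord phi 0 * coord phi 1 = Polynomial.aeval (coord phi 2) phi := by
  have h : Ideal.Quotient.mkₐ k (DanIdeal k phi) (X 0 * X 1 - Polynomial.aeval (X 2) phi) = 0 :=
    Ideal.Quotient.eq_zero_iff_mem.2 (Ideal.subset_span rfl)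
  rw [map_sub, map_mul, ← Polynomial.aeval_algHom_apply, sub_eq_zero] at h
  exact h

/-- Construct an algebra map out of `k[X,Y,Z]/(XY − φ(Z))`. -/
noncomputable def lift {phi : Polynomial k} {A : Type*} [CommRing A] [Algebra k A] (a b c : A)
    (h : a * b = Polynomial.aeval c phi) : Dan k phi →ₐ[k] A :=
  Ideal.Quotient.liftₐ (DanIdeal k phi) (MvPolynomial.aeval ![a, b, c]) (by
    intro p hp
    have : DanIdeal k phi ≤ RingHom.ker (MvPolynomial.aeval (R := k) ![a, b, c]) := by
      rw [Ideal.span_le, Set.singleton_subset_iff, SetLike.mem_coe, RingHom.mem_ker, map_sub,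
        map_mul, ← Polynomial.aeval_algHom_apply]
      simp [h]
    exact this hp)

lemma lift_coord {phi : Polynomial k} {A : Type*} [CommRing A] [Algebra k A] (a b c : A)
    (h : a * b = Polynomial.aeval c phi) (i : Fin 3) :
    lift a b c h (coord phi i) = ![a, b, c] i := by
  change MvPolynomial.aeval ![a, b, c] (X i) = _
  simp

@[ext] lemma algHom_ext {phi : Polynomial k} {A : Type*} [CommRing A] [Algebra k A]
    {f g : Dan k phi →ₐ[k] A} (h : ∀ i, f (coord phi i) = g (coord phi i)) : f = g :=
  Ideal.Quotient.algHom_ext k (MvPolynomial.algHom_ext fun i => h i)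

/-- The embedding of `k[X,Y,Z]/(XY − φ(Z))` into `k[z][x, x⁻¹]`. -/
noncomputable def toLau (phi : Polynomial k) : Dan k phi →ₐ[k] Lau k :=
  lift x (y phi) z (x_mul_y phi)

lemma toLau_coord (phi : Polynomial k) (i : Fin 3) :
    toLau phi (coord phi i) = ![x, y phi, z] i := lift_coord _ _ _ _ _

lemma range_toLau (phi : Polynomial k) : (toLau phi).range = M phi := by
  refine le_antisymm ?_ ((M_eq_adjoin phi).trans_le (Algebra.adjoin_le ?_))
  · rintro _ ⟨b, rfl⟩
    obtain ⟨p, rfl⟩ := Ideal.Quotient.mk_surjective b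
    change MvPolynomial.aeval ![x, y phi, z] p ∈ M phi
    rw [M_eq_adjoin]
    induction p using MvPolynomial.induction_on with
    | C a => rw [MvPolynomial.aeval_C]; exact Subalgebra.algebraMap_mem _ _
    | add p q hp hq => rw [map_add]; exact add_mem hp hq
    | mul_X p i hp =>
      rw [map_mul, MvPolynomial.aeval_X]
      refine mul_mem hp (Algebra.subset_adjoin ?_)
      fin_cases i <;> simp
  · rintro F (rfl | rfl | rfl)
    exacts [⟨coord phi 0, toLau_coord _ _⟩, ⟨coord phi 1, toLau_coord _ _⟩,
      ⟨coord phi 2, toLau_coord _ _⟩]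

/-- `xⁿ` for `n ≥ 0` and `y⁻ⁿ` for `n < 0`. -/
noncomputable def basisMon (phi : Polynomial k) (n : ℤ) : Dan k phi :=
  coord phi 0 ^ n.toNat * coord phi 1 ^ (-n).toNat

lemma x_mul_basisMon (phi : Polynomial k) (n : ℤ) : ∃ p : Polynomial k,
    coord phi 0 * basisMon phi n = Polynomial.aeval (coord phi 2) p * basisMon phi (n + 1) := by
  unfold basisMon
  rcases le_or_gt 0 n with h | h
  · refine ⟨1, ?_⟩
    rw [show (n + 1).toNat = n.toNat + 1 by omega, show (-n).toNat = 0 by omega,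
      show (-(n + 1)).toNat = 0 by omega, map_one]
    ring
  · refine ⟨phi, ?_⟩
    rw [show (n + 1).toNat = 0 by omega, show n.toNat = 0 by omega,
      show (-n).toNat = (-(n + 1)).toNat + 1 by omega, ← coord_rel]
    ring

lemma y_mul_basisMon (phi : Polynomial k) (n : ℤ) : ∃ p : Polynomial k,
    coord phi 1 * basisMon phi n = Polynomial.aeval (coord phi 2) p * basisMon phi (n - 1) := by
  unfold basisMon
  rcases lt_or_ge 0 n with h | h
  · refine ⟨phi, ?_⟩
    rw [show n.toNat = (n - 1).toNat + 1 by omega, show (-n).toNat = 0 by omega,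
      show (-(n - 1)).toNat = 0 by omega, ← coord_rel]
    ring
  · refine ⟨1, ?_⟩
    rw [show (n - 1).toNat = 0 by omega, show n.toNat = 0 by omega,
      show (-(n - 1)).toNat = (-n).toNat + 1 by omega, map_one]
    ring

/-- The normal form map `(pₙ) ↦ ∑ pₙ(z) mₙ`. -/
noncomputable def normalForm (phi : Polynomial k) : (ℤ →₀ Polynomial k) →+ Dan k phi :=
  Finsupp.liftAddHom fun n => (AddMonoidHom.mulRight (basisMon phi n)).comp
    (Polynomial.aeval (R := k) (coord phi 2)).toRingHom.toAddMonoidHom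

lemma normalForm_single (phi : Polynomial k) (n : ℤ) (p : Polynomial k) :
    normalForm phi (Finsupp.single n p) = Polynomial.aeval (coord phi 2) p * basisMon phi n := by
  rw [normalForm, Finsupp.liftAddHom_apply_single]; rfl

lemma normalForm_surjective (phi : Polynomial k) : Function.Surjective (normalForm phi) := by
  have hmul (a : Dan k phi) (m : ℤ) (h : ∀ n, ∃ p : Polynomial k,
      a * basisMon phi n = Polynomial.aeval (coord phi 2) p * basisMon phi (n + m))
      (b : Dan k phi) (hb : b ∈ (normalForm phi).range) : a * b ∈ (normalForm phi).range := by
    obtain ⟨F, rfl⟩ := hb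
    induction F using Finsupp.induction_linear with
    | zero => simp
    | add F G hF hG => rw [map_add, mul_add]; exact add_mem hF hG
    | single n p =>
      obtain ⟨q, hq⟩ := h n
      refine ⟨Finsupp.single (n + m) (p * q), ?_⟩
      rw [normalForm_single, normalForm_single, mul_left_comm, hq, map_mul, mul_assoc]
  intro b
  change b ∈ (normalForm phi).range
  obtain ⟨p, rfl⟩ := Ideal.Quotient.mk_surjective b
  induction p using MvPolynomial.induction_on with
  | C a =>
    refine ⟨Finsupp.single 0 (Polynomial.C a), ?_⟩
    rw [normalForm_single, Polynomial.aeval_C]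
    simp [basisMon]; rfl
  | add p q hp hq => rw [map_add]; exact add_mem hp hq
  | mul_X p i hp =>
    rw [map_mul, mul_comm]
    fin_cases i
    · exact hmul _ 1 (x_mul_basisMon phi) _ hp
    · exact hmul _ (-1) (y_mul_basisMon phi) _ hp
    · exact hmul _ 0 (fun n => ⟨Polynomial.X, by simp⟩) _ hp

lemma coeff_toLau_normalForm (phi : Polynomial k) (F : ℤ →₀ Polynomial k) (n : ℤ) :
    (toLau phi (normalForm phi F)).coeff n = phi ^ (-n).toNat * F n := by
  induction F using Finsupp.induction_linear with
  | zero => simp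
  | add F G hF hG =>
    rw [map_add, map_add, AddMonoidAlgebra.coeff_add, Finsupp.add_apply, hF, hG, Finsupp.add_apply,
      mul_add]
  | single m p =>
    have : toLau phi (normalForm phi (Finsupp.single m p)) = mono m (p * phi ^ (-m).toNat) := by
      rw [normalForm_single, basisMon, map_mul, map_mul, map_pow, map_pow,
        ← Polynomial.aeval_algHom_apply, toLau_coord, toLau_coord, toLau_coord]
      change Polynomial.aeval z p * (x ^ m.toNat * y phi ^ (-m).toNat) = _
      rw [aeval_z, mono_pow, mono_pow, mono_mul_mono, mono_mul_mono]
      congr 1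
      · omega
      · simp
    rw [this, coeff_mono, Finsupp.single_apply]
    split_ifs with h
    · rw [h, mul_comm]
    · simp

lemma toLau_injective {phi : Polynomial k} (hphi : phi ≠ 0) :
    Function.Injective (toLau phi) := by
  rw [injective_iff_map_eq_zero]
  intro b hb
  obtain ⟨F, rfl⟩ := normalForm_surjective phi b
  have : F = 0 := by
    ext n : 1
    have := coeff_toLau_normalForm phi F n
    rw [hb, AddMonoidAlgebra.coeff_zero, Finsupp.zero_apply, zero_eq_mul] at this
    exact this.resolve_left (pow_ne_zero _ hphi)
  rw [this, map_zero]

end Dan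

section Hamiltonian

open Lau

variable {A : Type*} [CommRing A] [Algebra k A] {phi : Polynomial k} {j : A →ₐ[k] Lau k}

lemma IsLND.iterate {D : Derivation k A A} (h : IsLND D) (a : A) : ∃ n, D^[n] a = 0 := by
  obtain ⟨n, hn⟩ := h a
  refine ⟨n, ?_⟩
  rw [Module.End.pow_apply] at hn
  exact hn

/-- A derivation of a Danielewski ring extends to `k[z][x, x⁻¹]`. -/
lemma exists_extension (hj : Function.Injective j) (hr : j.range = M phi)
    (D : Derivation k A A) :
    ∃ a b : Lau k, ∀ c, (a • dz + b • th : Derivation k _ _) (j c) = j (D c) := by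
  obtain ⟨xA, hx⟩ : x ∈ j.range := hr ▸ x_mem phi
  obtain ⟨yA, hy⟩ : y phi ∈ j.range := hr ▸ y_mem phi
  obtain ⟨zA, hz⟩ : z ∈ j.range := hr ▸ z_mem phi
  simp only [AlgHom.toRingHom_eq_coe, RingHom.coe_coe] at hx hy hz
  refine ⟨j (D zA), xinv * j (D xA), ?_⟩
  set E : Derivation k (Lau k) (Lau k) := j (D zA) • dz + (xinv * j (D xA)) • th with hE
  have hEz : E z = j (D zA) := by
    simp [hE, dz_z, th_z]
  have hEx : E x = j (D xA) := by
    simp only [hE, Derivation.add_apply, Derivation.smul_apply, dz_x, th_x, smul_eq_mul]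
    linear_combination j (D xA) * xinv_mul_x (k := k)
  have hEy : E (y phi) = j (D yA) := by
    have h1 : xA * yA = Polynomial.aeval zA phi := by
      apply hj
      rw [map_mul, hx, hy, x_mul_y, ← Polynomial.aeval_algHom_apply, hz]
    have h2 := congrArg (fun c => j (D c)) h1
    have h3 := congrArg E (x_mul_y phi)
    simp only [Derivation.leibniz, Derivation.map_aeval, smul_eq_mul, map_add, map_mul,
      ← Polynomial.aeval_algHom_apply, hx, hy, hz, hEz, hEx] at h2 h3
    refine mul_left_cancel₀ x_ne_zero ?_
    linear_combination h3 - h2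
  let S : Subalgebra k A :=
    { carrier := {c | E (j c) = j (D c)}
      mul_mem' := fun {a b} ha hb => by
        simp only [Set.mem_ofPred_eq, map_mul, Derivation.leibniz, smul_eq_mul, map_add] at *
        rw [ha, hb]
      add_mem' := fun {a b} ha hb => by
        simp only [Set.mem_ofPred_eq, map_add] at *
        rw [ha, hb]
      algebraMap_mem' := fun r => by
        change E (j (algebraMap k A r)) = j (D (algebraMap k A r))
        rw [AlgHom.commutes, Derivation.map_algebraMap, Derivation.map_algebraMap, map_zero] }
  have hS : M phi ≤ S.map j := by
    rw [M_eq_adjoin]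
    refine Algebra.adjoin_le ?_
    rintro F (rfl | rfl | rfl)
    · exact ⟨xA, by change E (j xA) = _; rw [hx, hEx], hx⟩
    · exact ⟨yA, by change E (j yA) = _; rw [hy, hEy], hy⟩
    · exact ⟨zA, by change E (j zA) = _; rw [hz, hEz], hz⟩
  intro c
  obtain ⟨c', hc', h⟩ := hS (hr ▸ ⟨c, rfl⟩ : j c ∈ M phi)
  rw [← hj h]
  exact hc'

theorem IsLND.exists_hamiltonian [CharZero k] (hphi : 1 ≤ phi.natDegree)
    (hj : Function.Injective j) (hr : j.range = M phi)
    {D : Derivation k A A} (hD : IsLND D) : ∃ h : A, ∀ c, j (D c) = br (j h) (j c) := by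
  obtain ⟨a, b, hab⟩ := exists_extension hj hr D
  have hM (F : Lau k) (hF : F ∈ M phi) : (a • dz + b • th : Derivation k _ _) F ∈ M phi := by
    rw [← hr] at hF ⊢
    obtain ⟨c, rfl⟩ := hF
    exact ⟨D c, (hab c).symm⟩
  have hit (n : ℕ) (c : A) : (a • dz + b • th : Derivation k _ _)^[n] (j c) = j (D^[n] c) := by
    induction n with
    | zero => rfl
    | succ n ih => rw [Function.iterate_succ_apply', ih, hab, Function.iterate_succ_apply']
  have hnil (F : Lau k) (hF : F ∈ M phi) :
      ∃ n, (a • dz + b • th : Derivation k _ _)^[n] F = 0 := by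
    rw [← hr] at hF
    obtain ⟨c, rfl⟩ := hF
    obtain ⟨n, hn⟩ := hD.iterate c
    exact ⟨n, (hit n c).trans (by rw [hn, map_zero])⟩
  obtain ⟨h, hh, hF⟩ := Lau.exists_hamiltonian hphi a b hM hnil
  rw [← hr] at hh
  obtain ⟨h, rfl⟩ := hh
  exact ⟨h, fun c => (hab c).symm.trans (hF _)⟩

lemma const_of_br_eq_zero [CharZero k] (hr : j.range = M phi) {q : Lau k}
    (h : ∀ c, br q (j c) = 0) : ∃ c, q = algebraMap k (Lau k) c := by
  obtain ⟨xA, hx⟩ : x ∈ j.range := hr ▸ x_mem phi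
  obtain ⟨zA, hz⟩ : z ∈ j.range := hr ▸ z_mem phi
  simp only [AlgHom.toRingHom_eq_coe, RingHom.coe_coe] at hx hz
  have h1 := h xA
  have h2 := h zA
  rw [hx, br_skew, br_x, neg_neg, mul_eq_zero, or_iff_right x_ne_zero] at h1
  rw [hz, br_skew, br_z, neg_eq_zero] at h2
  exact eq_const_of_casimir h1 h2

end Hamiltonian

section SL2

/-- For an `sl₂`-action with `D` and `U` nilpotent, the weight zero vectors are generated by the
image of `U` and the invariants. -/
lemma sl2_decomp [CharZero k] {V : Type*} [AddCommGroup V] [Module k V] (D U E : V →ₗ[k] V)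
    (hDU : ∀ v, D (U v) = U (D v) + E v) (hED : ∀ v, E (D v) = D (E v) + (2 : k) • D v)
    (hEU : ∀ v, E (U v) = U (E v) - (2 : k) • U v) (hU : ∀ v, ∃ n, U^[n] v = 0) (n : ℕ) :
    ∀ v, D^[n] v = 0 → E v = 0 → ∃ v' q, v = U v' + q ∧ D q = 0 ∧ U q = 0 := by
  have hEUj (w : V) (m : k) (hw : E w = m • w) (i : ℕ) :
      E (U^[i] w) = (m - 2 * i) • U^[i] w := by
    induction i with
    | zero => simpa using hw
    | succ i ih =>
      rw [Function.iterate_succ_apply', hEU, ih, map_smul, ← sub_smul]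
      congr 1; push_cast; ring
  have hDUj (w : V) (m : k) (hw : E w = m • w) (hDw : D w = 0) (i : ℕ) :
      D (U^[i + 1] w) = ((i + 1) * (m - i)) • U^[i] w := by
    induction i with
    | zero => simp [hDU, hDw, hw]
    | succ i ih =>
      rw [Function.iterate_succ_apply', hDU, ih, map_smul, ← Function.iterate_succ_apply' U i w,
        hEUj w m hw, ← add_smul]
      congr 1; push_cast; ring
  have hEDj (v : V) (hv : E v = 0) (i : ℕ) : E (D^[i] v) = (2 * i : k) • D^[i] v := by
    induction i with
    | zero => simpa using hv
    | succ i ih =>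
      rw [Function.iterate_succ_apply', hED, ih, map_smul, ← add_smul]
      congr 1; push_cast; ring
  induction n with
  | zero => rintro v (rfl : v = 0) -; exact ⟨0, 0, by simp⟩
  | succ n ih =>
    intro v hv hEv
    rcases Nat.eq_zero_or_pos n with rfl | hn
    · refine ⟨0, v, by simp, hv, ?_⟩
      by_cases h0 : v = 0
      · simp [h0]
      obtain ⟨i, hi, hi'⟩ := Lau.exists_last_iterate U h0 (hU v)
      have := hDUj v 0 (by simpa using hEv) hv i
      rw [hi', map_zero, eq_comm, smul_eq_zero, or_iff_left hi, mul_eq_zero,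
        or_iff_right (by exact_mod_cast i.succ_ne_zero), zero_sub, neg_eq_zero,
        Nat.cast_eq_zero] at this
      subst this
      exact hi'
    · set w := D^[n] v with hw
      have hDw : D w = 0 := by rw [hw, ← Function.iterate_succ_apply' D n v, hv]
      have hEw := hEDj v hEv n
      have hc (i : ℕ) (hi : i ≤ n) : ∃ c : k, c ≠ 0 ∧ D^[i] (U^[n] w) = c • U^[n - i] w := by
        induction i with
        | zero => exact ⟨1, one_ne_zero, by simp⟩
        | succ i ihi =>
          obtain ⟨c, hc, h⟩ := ihi (by omega)
          obtain ⟨a, ha⟩ : ∃ a, n - i = a + 1 := ⟨n - i - 1, by omega⟩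
          refine ⟨c * ((a + 1) * (2 * n - a)), ?_, ?_⟩
          · refine mul_ne_zero hc (mul_ne_zero (by exact_mod_cast a.succ_ne_zero) ?_)
            rw [sub_ne_zero]
            exact_mod_cast (show 2 * n ≠ a by omega)
          · rw [Function.iterate_succ_apply', h, map_smul, ha, hDUj w _ hEw hDw, smul_smul,
              show n - (i + 1) = a by omega]
      obtain ⟨c, hc, h⟩ := hc n le_rfl
      rw [Nat.sub_self, Function.iterate_zero, id] at h
      obtain ⟨v', q, hq, hq'⟩ := ih (v - c⁻¹ • U^[n] w) (by
        rw [iterate_map_sub, ← Module.End.pow_apply D, ← Module.End.pow_apply D, map_smul,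
          Module.End.pow_apply, Module.End.pow_apply, h, smul_smul, inv_mul_cancel₀ hc, one_smul,
          sub_self]) (by
        rw [map_sub, hEv, map_smul, hEUj w _ hEw, sub_self, zero_smul, smul_zero, sub_zero])
      refine ⟨v' + c⁻¹ • U^[n - 1] w, q, ?_, hq'⟩
      rw [map_add, map_smul, ← Function.iterate_succ_apply' U (n - 1) w,
        show (n - 1).succ = n by omega, add_right_comm, ← hq, sub_add_cancel]

end SL2

end DanModel

section FundamentalPair

open Lau

variable {k : Type*} [Field k] [CharZero k] {A : Type*} [CommRing A] [Algebra k A]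
  {D U : Derivation k A A}

/-- A fundamental pair makes the ring the sum of the images of `D`, `U` and the invariants. -/
lemma IsFundamentalPair.decomp (h : IsFundamentalPair D U) (b : A) :
    ∃ b₁ b₂ q, b = D b₁ + U b₂ + q ∧ D q = 0 ∧ U q = 0 := by
  obtain ⟨hD, hU, h1, h2, h3⟩ := h
  have hDU (v : A) : D (U v) = U (D v) + ⁅D, U⁆ v := by rw [Derivation.commutator_apply]; ring
  have hED (v : A) : ⁅D, U⁆ (D v) = D (⁅D, U⁆ v) + (2 : k) • D v := by
    have := DFunLike.congr_fun h1 v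
    rw [Derivation.commutator_apply, Derivation.smul_apply, zsmul_eq_mul] at this
    rw [ofNat_smul_eq_nsmul, nsmul_eq_mul]
    push_cast at *
    linear_combination -this
  have hEU (v : A) : ⁅D, U⁆ (U v) = U (⁅D, U⁆ v) - (2 : k) • U v := by
    have := DFunLike.congr_fun h2 v
    rw [Derivation.commutator_apply, Derivation.smul_apply, zsmul_eq_mul] at this
    rw [ofNat_smul_eq_nsmul, nsmul_eq_mul]
    push_cast at *
    linear_combination -this
  have hb : b ∈ ⨆ d : ℤ, gradePiece D U d := h3 ▸ Submodule.mem_top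
  induction hb using Submodule.iSup_induction' with
  | mem d b hb =>
    have hE : ⁅D, U⁆ b = (d : k) • b := by
      rw [gradePiece, LinearMap.mem_ker, LinearMap.sub_apply, sub_eq_zero] at hb
      rw [Int.cast_smul_eq_zsmul]
      exact hb
    by_cases hd : (d : k) = 0
    · obtain ⟨n, hn⟩ := hD.iterate b
      obtain ⟨v, q, hv, hq⟩ := sl2_decomp (D : A →ₗ[k] A) U (⁅D, U⁆ : Derivation k A A)
        hDU hED hEU hU.iterate n b hn (by
          change ⁅D, U⁆ b = 0
          rw [hE, hd, zero_smul])
      exact ⟨0, v, q, by rw [map_zero, zero_add]; exact hv, hq⟩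
    · refine ⟨(d : k)⁻¹ • U b, -(d : k)⁻¹ • D b, 0, ?_, map_zero _, map_zero _⟩
      rw [Derivation.map_smul, Derivation.map_smul, hDU, hE, neg_smul, smul_add, smul_smul, inv_mul_cancel₀ hd, one_smul]
      ring
  | zero => exact ⟨0, 0, 0, by simp⟩
  | add b b' _ _ hb hb' =>
    obtain ⟨b₁, b₂, q, rfl, hq, hq'⟩ := hb
    obtain ⟨c₁, c₂, r, rfl, hr, hr'⟩ := hb'
    refine ⟨b₁ + c₁, b₂ + c₂, q + r, ?_, ?_, ?_⟩
    · simp only [map_add]; ring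
    · rw [map_add, hq, hr, add_zero]
    · rw [map_add, hq', hr', add_zero]

lemma IsFundamentalPair.commutator_ne_zero (h : IsFundamentalPair D U) (hnt : ¬(D = 0 ∧ U = 0)) :
    ⁅D, U⁆ ≠ 0 := by
  obtain ⟨-, -, h1, h2, -⟩ := h
  intro hE
  rw [hE, lie_zero] at h1 h2
  have key (c : ℤ) (hc : c ≠ 0) (F : Derivation k A A) (hF : 0 = c • F) : F = 0 := by
    ext v
    have := DFunLike.congr_fun hF v
    rw [Derivation.smul_apply, ← Int.cast_smul_eq_zsmul k, Derivation.zero_apply, eq_comm] at this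
    exact (smul_eq_zero_iff_right (by exact_mod_cast hc)).1 this
  exact hnt ⟨key _ (by norm_num) _ h1, key _ (by norm_num) _ h2⟩

theorem IsFundamentalPair.natDegree_le_two {phi : Polynomial k} {j : A →ₐ[k] Lau k}
    (hphi : 1 ≤ phi.natDegree) (hj : Function.Injective j) (hr : j.range = M phi)
    (h : IsFundamentalPair D U) (hnt : ¬(D = 0 ∧ U = 0)) : phi.natDegree ≤ 2 := by
  obtain ⟨f, hf⟩ := h.1.exists_hamiltonian hphi hj hr
  obtain ⟨g, hg⟩ := h.2.1.exists_hamiltonian hphi hj hr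
  have hjM (c : A) : j c ∈ M phi := hr ▸ ⟨c, rfl⟩
  have hfg : br (j f) (j g) ≠ 0 := by
    intro h0
    refine h.commutator_ne_zero hnt (Derivation.ext fun v => hj ?_)
    rw [Derivation.commutator_apply, map_sub, hf, hg, hg, hf, br_jacobi, h0]
    simp [br]
  obtain ⟨zA, hz⟩ : z ∈ j.range := hr ▸ z_mem phi
  replace hz : j zA = z := hz
  obtain ⟨b₁, b₂, q, hb, hDq, hUq⟩ := h.decomp zA
  have hq (d : A) : br (j q) (j d) = 0 := by
    have := br_plucker (j f) (j g) (j q) (j d)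
    rw [← hf q, ← hg q, hDq, hUq, map_zero, zero_mul, mul_zero, sub_zero, add_zero] at this
    exact (mul_eq_zero.1 this).resolve_left hfg
  obtain ⟨c, hc⟩ := const_of_br_eq_zero hr hq
  obtain ⟨r₁, hr₁⟩ := coeff_zero_br (hjM f) (hjM b₁)
  obtain ⟨r₂, hr₂⟩ := coeff_zero_br (hjM g) (hjM b₂)
  have hX : (Polynomial.X : Polynomial k) = Polynomial.derivative (phi * (r₁ + r₂)) +
      Polynomial.C c := by
    have := congrArg (fun F => (j F).coeff 0) hb
    simp only [map_add, hz, hf, hg, hc, ← mono_zero_C] at this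
    rw [AddMonoidAlgebra.coeff_add, AddMonoidAlgebra.coeff_add, Finsupp.add_apply,
      Finsupp.add_apply, hr₁, hr₂, coeff_mono,
      coeff_mono, if_pos rfl, if_pos rfl] at this
    rw [this, mul_add, map_add]
  have hdeg : Polynomial.natDegree (Polynomial.derivative (phi * (r₁ + r₂))) = 1 := by
    rw [← sub_eq_iff_eq_add.2 hX, Polynomial.natDegree_X_sub_C]
  rw [Polynomial.natDegree_derivative] at hdeg
  have hne : phi * (r₁ + r₂) ≠ 0 := by
    intro h0
    simp [h0] at hdeg
  have := Polynomial.natDegree_le_of_dvd (Dvd.intro _ rfl) hne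
  omega

end FundamentalPair

section Quadratic

open Lau

variable {k : Type*} [Field k]

namespace Slam

/-- The class of the `i`-th coordinate. -/
noncomputable abbrev coord (lam : k) (i : Fin 3) : Slam k lam :=
  Ideal.Quotient.mk (SIdeal k lam) (X i)

lemma coord_rel (lam : k) :
    2 * coord lam 0 * coord lam 2 - coord lam 1 ^ 2 = algebraMap k _ lam := by
  have h : Ideal.Quotient.mkₐ k (SIdeal k lam) (2 * X 0 * X 2 - X 1 ^ 2 - C lam) = 0 :=
    Ideal.Quotient.eq_zero_iff_mem.2 (Ideal.subset_span rfl)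
  rw [map_sub, sub_eq_zero, map_sub, map_mul, map_mul, map_pow, map_ofNat] at h
  exact h

/-- Construct an algebra map out of `S_λ(k)`. -/
noncomputable def lift {lam : k} {A : Type*} [CommRing A] [Algebra k A] (a b c : A)
    (h : 2 * a * c - b ^ 2 = algebraMap k A lam) : Slam k lam →ₐ[k] A :=
  Ideal.Quotient.liftₐ (SIdeal k lam) (MvPolynomial.aeval ![a, b, c]) (by
    intro p hp
    have : SIdeal k lam ≤ RingHom.ker (MvPolynomial.aeval (R := k) ![a, b, c]) := by
      rw [Ideal.span_le, Set.singleton_subset_iff, SetLike.mem_coe, RingHom.mem_ker, map_sub,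
        MvPolynomial.aeval_C, sub_eq_zero, ← h]
      simp
    exact this hp)

lemma lift_coord {lam : k} {A : Type*} [CommRing A] [Algebra k A] (a b c : A)
    (h : 2 * a * c - b ^ 2 = algebraMap k A lam) (i : Fin 3) :
    lift a b c h (coord lam i) = ![a, b, c] i := by
  change MvPolynomial.aeval ![a, b, c] (X i) = _
  simp

@[ext] lemma algHom_ext {lam : k} {A : Type*} [CommRing A] [Algebra k A]
    {f g : Slam k lam →ₐ[k] A} (h : ∀ i, f (coord lam i) = g (coord lam i)) : f = g :=
  Ideal.Quotient.algHom_ext k (MvPolynomial.algHom_ext fun i => h i)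

variable [CharZero k]

/-- Completing the square identifies a Danielewski surface with quadratic `φ` with `S_λ(k)`. -/
noncomputable def danEquiv {phi : Polynomial k} {a q lam : k} (ha : a ≠ 0)
    (hphi : phi = Polynomial.C a * ((Polynomial.X + Polynomial.C q) ^ 2 + Polynomial.C lam)) :
    Dan k phi ≃ₐ[k] Slam k lam := by
  have hphi' {A : Type _} [CommRing A] [Algebra k A] (t : A) : Polynomial.aeval t phi =
      algebraMap k A a * ((t + algebraMap k A q) ^ 2 + algebraMap k A lam) := by
    simp [hphi]
  have h2 {A : Type _} [CommRing A] [Algebra k A] :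
      2 * algebraMap k A a * algebraMap k A (2 * a)⁻¹ = 1 := by
    rw [← map_ofNat (algebraMap k A) 2, ← map_mul, ← map_mul, mul_inv_cancel₀ (by simpa), map_one]
  refine AlgEquiv.ofAlgHom
    (Dan.lift (coord lam 0) (algebraMap k _ (2 * a) * coord lam 2)
      (coord lam 1 - algebraMap k _ q) ?_)
    (lift (Dan.coord phi 0) (Dan.coord phi 2 + algebraMap k _ q)
      (algebraMap k _ (2 * a)⁻¹ * Dan.coord phi 1) ?_) ?_ ?_
  · rw [hphi', ← coord_rel lam, map_mul, map_ofNat]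
    ring
  · have := Dan.coord_rel phi
    rw [hphi'] at this
    linear_combination 2 * algebraMap k _ (2 * a)⁻¹ * this +
      ((Dan.coord phi 2 + algebraMap k _ q) ^ 2 + algebraMap k _ lam) * h2 (A := Dan k phi)
  · ext i
    rw [AlgHom.comp_apply, lift_coord, AlgHom.id_apply]
    fin_cases i
    · exact Dan.lift_coord _ _ _ _ 0
    · change Dan.lift _ _ _ _ (Dan.coord phi 2 + algebraMap k _ q) = coord lam 1
      rw [map_add, AlgHom.commutes, Dan.lift_coord]
      exact sub_add_cancel _ _
    · change Dan.lift _ _ _ _ (algebraMap k _ (2 * a)⁻¹ * Dan.coord phi 1) = coord lam 2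
      rw [map_mul, AlgHom.commutes, Dan.lift_coord]
      change algebraMap k _ (2 * a)⁻¹ * (algebraMap k _ (2 * a) * coord lam 2) = _
      rw [map_mul, map_ofNat]
      linear_combination coord lam 2 * h2 (A := Slam k lam)
  · ext i
    rw [AlgHom.comp_apply, Dan.lift_coord, AlgHom.id_apply]
    fin_cases i
    · exact lift_coord _ _ _ _ 0
    · change lift _ _ _ _ (algebraMap k _ (2 * a) * coord lam 2) = Dan.coord phi 1
      rw [map_mul, AlgHom.commutes, lift_coord]
      change algebraMap k _ (2 * a) * (algebraMap k _ (2 * a)⁻¹ * Dan.coord phi 1) = _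
      rw [map_mul, map_ofNat]
      linear_combination Dan.coord phi 1 * h2 (A := Dan k phi)
    · change lift _ _ _ _ (coord lam 1 - algebraMap k _ q) = Dan.coord phi 2
      rw [map_sub, AlgHom.commutes, lift_coord]
      exact add_sub_cancel_right _ _

end Slam

/-- Parametrisation of the quadric cone `XY = Z²` by `(u², v², uv)`. -/
noncomputable def coneParam (k : Type*) [Field k] :
    Dan k (Polynomial.X ^ 2 : Polynomial k) →ₐ[k] MvPolynomial (Fin 2) k :=
  Dan.lift (X 0 ^ 2) (X 1 ^ 2) (X 0 * X 1) (by simp [mul_pow])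

lemma coneParam_coord (i : Fin 3) : coneParam k (Dan.coord _ i) =
    ![X 0 ^ 2, X 1 ^ 2, X 0 * X 1] i := Dan.lift_coord _ _ _ _ _

lemma range_coneParam : (coneParam k).range = coneRNC2 k := by
  refine le_antisymm ?_ (Algebra.adjoin_le ?_)
  · rintro _ ⟨b, rfl⟩
    obtain ⟨p, rfl⟩ := Ideal.Quotient.mk_surjective b
    change MvPolynomial.aeval ![X 0 ^ 2, X 1 ^ 2, X 0 * X 1] p ∈ coneRNC2 k
    induction p using MvPolynomial.induction_on with
    | C a => rw [MvPolynomial.aeval_C]; exact Subalgebra.algebraMap_mem _ _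
    | add p q hp hq => rw [map_add]; exact add_mem hp hq
    | mul_X p i hp =>
      rw [map_mul, MvPolynomial.aeval_X]
      refine mul_mem hp (Algebra.subset_adjoin ?_)
      fin_cases i <;> simp
  · rintro F (rfl | rfl | rfl)
    exacts [⟨Dan.coord _ 0, coneParam_coord _⟩, ⟨Dan.coord _ 2, coneParam_coord _⟩,
      ⟨Dan.coord _ 1, coneParam_coord _⟩]

lemma coneParam_injective : Function.Injective (coneParam k) := by
  let s : Lau k →ₐ[k] Lau k :=
    (AddMonoidAlgebra.mapDomainAlgHom (Polynomial k) (Polynomial k)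
      (AddMonoidHom.mulLeft (2 : ℤ))).restrictScalars k
  have hs (n : ℤ) (p : Polynomial k) : s (mono n p) = mono (2 * n) p :=
    AddMonoidAlgebra.mapDomain_single
  have hs' : Function.Injective s :=
    AddMonoidAlgebra.mapDomain_injective (mul_right_injective₀ (two_ne_zero (α := ℤ)))
  have hcomp : (MvPolynomial.aeval ![(x : Lau k), z * xinv]).comp (coneParam k) =
      s.comp (Dan.toLau _) := by
    ext i : 1
    rw [AlgHom.comp_apply, AlgHom.comp_apply, coneParam_coord, Dan.toLau_coord]
    fin_cases i
    · change MvPolynomial.aeval ![(x : Lau k), z * xinv] (X 0 ^ 2) = s x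
      rw [hs, map_pow, MvPolynomial.aeval_X]
      change (x : Lau k) ^ 2 = _
      rw [mono_pow]; simp
    · change MvPolynomial.aeval ![(x : Lau k), z * xinv] (X 1 ^ 2) = s (y _)
      rw [hs, map_pow, MvPolynomial.aeval_X]
      change (z * xinv : Lau k) ^ 2 = _
      rw [mono_mul_mono, mono_pow]; simp
    · change MvPolynomial.aeval ![(x : Lau k), z * xinv] (X 0 * X 1) = s z
      rw [hs, map_mul, MvPolynomial.aeval_X, MvPolynomial.aeval_X]
      change (x : Lau k) * (z * xinv) = _
      rw [mono_mul_mono, mono_mul_mono]; simp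
  refine Function.Injective.of_comp (f := MvPolynomial.aeval ![(x : Lau k), z * xinv]) ?_
  rw [← AlgHom.coe_comp, hcomp, AlgHom.coe_comp]
  exact hs'.comp (Dan.toLau_injective (pow_ne_zero _ Polynomial.X_ne_zero))

variable [CharZero k]

theorem Dan.equiv_of_natDegree_eq_two {phi : Polynomial k} (h : phi.natDegree = 2) :
    Nonempty (Dan k phi ≃ₐ[k] ↥(coneRNC2 k)) ∨
      ∃ lam : k, lam ≠ 0 ∧ Nonempty (Dan k phi ≃ₐ[k] Slam k lam) := by
  have ha : phi.coeff 2 ≠ 0 := by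
    rw [← h, Polynomial.coeff_natDegree, Polynomial.leadingCoeff_ne_zero]
    rintro rfl
    simp at h
  obtain ⟨a, q, lam, ha, hphi⟩ : ∃ a q lam : k, a ≠ 0 ∧
      phi = Polynomial.C a * ((Polynomial.X + Polynomial.C q) ^ 2 + Polynomial.C lam) := by
    obtain ⟨q, hq⟩ : ∃ q, phi.coeff 1 = phi.coeff 2 * (2 * q) :=
      ⟨phi.coeff 1 / (2 * phi.coeff 2), by field_simp⟩
    obtain ⟨l, hl⟩ : ∃ l, phi.coeff 0 = phi.coeff 2 * (q ^ 2 + l) :=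
      ⟨phi.coeff 0 / phi.coeff 2 - q ^ 2, by field_simp; ring⟩
    refine ⟨phi.coeff 2, q, l, ha, ?_⟩
    have := Polynomial.eq_quadratic_of_degree_le_two (Polynomial.natDegree_le_iff_degree_le.1 h.le)
    rw [hq, hl] at this
    simp only [map_mul, map_add, map_pow, map_ofNat] at this
    refine this.trans ?_
    ring
  by_cases hlam : lam = 0
  · subst hlam
    refine Or.inl ⟨(Slam.danEquiv ha hphi).trans ((Slam.danEquiv (phi := Polynomial.X ^ 2) (q := 0)
      one_ne_zero (by simp)).symm.trans ?_)⟩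
    exact (AlgEquiv.ofInjective _ coneParam_injective).trans
      (Subalgebra.equivOfEq _ _ range_coneParam)
  · exact Or.inr ⟨lam, hlam, ⟨Slam.danEquiv ha hphi⟩⟩

end Quadratic

section Quotient

open Lau

section Derivation

variable {k : Type*} [Field k] {A B : Type*} [CommRing A] [Algebra k A] [CommRing B] [Algebra k B]

/-- The elements killed by some power of a derivation form a subalgebra. -/
def Derivation.nilSubalgebra (D : Derivation k A A) : Subalgebra k A where
  carrier := {a | ∃ n, D^[n] a = 0}
  add_mem' := by
    rintro a b ⟨m, hm⟩ ⟨n, hn⟩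
    refine ⟨m + n, ?_⟩
    rw [iterate_map_add, Function.iterate_add_apply D m n b, hn, add_comm m n,
      Function.iterate_add_apply, hm, iterate_map_zero, iterate_map_zero, add_zero]
  mul_mem' := by
    have key (n : ℕ) : ∀ (i l : ℕ) (a b : A), i + l = n → D^[i] a = 0 → D^[l] b = 0 →
        D^[n] (a * b) = 0 := by
      induction n with
      | zero =>
        intro i l a b h ha _
        obtain rfl : i = 0 := by omega
        simp_all
      | succ n ih =>
        intro i l a b h ha hb
        rcases i with _ | i
        · rw [show a = 0 from ha, zero_mul, iterate_map_zero]
        rcases l with _ | l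
        · rw [show b = 0 from hb, mul_zero, iterate_map_zero]
        rw [Function.iterate_succ_apply, Derivation.leibniz, iterate_map_add, smul_eq_mul,
          smul_eq_mul, ih (i + 1) l a (D b) (by omega) ha hb,
          ih (l + 1) i b (D a) (by omega) hb ha, add_zero]
    rintro a b ⟨m, hm⟩ ⟨n, hn⟩
    exact ⟨m + n, key _ m n a b rfl hm hn⟩
  algebraMap_mem' r := ⟨1, D.map_algebraMap r⟩

lemma Derivation.exists_restrict {j : A →ₐ[k] B} (hj : Function.Injective j)
    (D : Derivation k B B) (h : ∀ a, D (j a) ∈ j.range) :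
    ∃ D' : Derivation k A A, ∀ a, j (D' a) = D (j a) := by
  choose f hf using h
  replace hf (a : A) : j (f a) = D (j a) := hf a
  refine ⟨Derivation.mk' { toFun := f, map_add' := fun a b => hj ?_, map_smul' := fun c a => hj ?_ }
    fun a b => hj ?_, hf⟩
  · rw [map_add, hf, hf, hf, map_add, map_add]
  · change j (f (c • a)) = j (c • f a)
    rw [_root_.map_smul, hf, hf, _root_.map_smul, Derivation.map_smul]
  · change j (f (a * b)) = j (a * f b + b * f a)
    rw [map_add, map_mul, map_mul, hf, hf, hf, map_mul, Derivation.leibniz, smul_eq_mul,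
      smul_eq_mul]

lemma IsLND.of_restrict {j : A →ₐ[k] B} (hj : Function.Injective j) {D : Derivation k B B}
    {D' : Derivation k A A} (hD' : ∀ a, j (D' a) = D (j a)) (h : j.range ≤ D.nilSubalgebra) :
    IsLND D' := by
  intro a
  obtain ⟨n, hn⟩ := h ⟨a, rfl⟩
  refine ⟨n, hj ?_⟩
  have hit (n : ℕ) : j (D'^[n] a) = D^[n] (j a) := by
    induction n with
    | zero => rfl
    | succ n ih => rw [Function.iterate_succ_apply', Function.iterate_succ_apply', hD', ih]
  rw [Module.End.pow_apply, map_zero]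
  exact (hit n).trans hn

end Derivation

variable {k : Type*} [Field k] (lam : k)

namespace Slam

/-- The involution `xᵢ ↦ -xᵢ`. -/
noncomputable def neg : Slam k lam →ₐ[k] Slam k lam :=
  lift (-coord lam 0) (-coord lam 1) (-coord lam 2) (by rw [← coord_rel]; ring)

lemma neg_coord (i : Fin 3) : neg lam (coord lam i) = -coord lam i := by
  rw [neg, lift_coord]
  fin_cases i <;> rfl

/-- The polynomial `(T² + λ)/2`, for which `S_λ(k)` is the ring `xy = φ(z)`. -/
noncomputable def quad : Polynomial k :=
  Polynomial.C (1 / 2) * ((Polynomial.X + Polynomial.C 0) ^ 2 + Polynomial.C lam)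

variable [CharZero k]

lemma derivative_quad : Polynomial.derivative (quad lam) = Polynomial.X := by
  have : Polynomial.C (1 / 2 : k) * 2 = 1 := by
    rw [← map_ofNat Polynomial.C, ← map_mul]; simp
  simp only [quad, map_zero, add_zero, Polynomial.derivative_mul, Polynomial.derivative_C,
    Polynomial.derivative_add, Polynomial.derivative_X_sq]
  rw [map_ofNat]
  linear_combination Polynomial.X * this

lemma quad_ne_zero : quad lam ≠ 0 := fun h => by
  have := derivative_quad lam
  rw [h, map_zero] at this
  exact Polynomial.X_ne_zero this.symm

/-- The embedding of `S_λ(k)` into `k[z][x, x⁻¹]`. -/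
noncomputable def toLau : Slam k lam →ₐ[k] Lau k :=
  (Dan.toLau (quad lam)).comp (danEquiv (phi := quad lam) (by simp) rfl).symm.toAlgHom

lemma toLau_injective : Function.Injective (toLau lam) :=
  (Dan.toLau_injective (quad_ne_zero lam)).comp (AlgEquiv.injective _)

lemma toLau_coord (i : Fin 3) : toLau lam (coord lam i) = ![x, z, y (quad lam)] i := by
  have h (i : Fin 3) : toLau lam (coord lam i) = Dan.toLau (quad lam) (![Dan.coord (quad lam) 0,
      Dan.coord (quad lam) 2 + algebraMap k (Dan k (quad lam)) 0,
      algebraMap k (Dan k (quad lam)) (2 * (1 / 2))⁻¹ * Dan.coord (quad lam) 1] i) := by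
    refine congrArg (Dan.toLau (quad lam)) ?_
    exact MvPolynomial.aeval_X _ i
  rw [h]
  fin_cases i
  · exact Dan.toLau_coord _ 0
  · change Dan.toLau _ (Dan.coord _ 2 + algebraMap k _ 0) = z
    rw [map_zero, add_zero]
    exact Dan.toLau_coord _ 2
  · change Dan.toLau _ (algebraMap k _ (2 * (1 / 2))⁻¹ * Dan.coord _ 1) = y _
    rw [show (2 * (1 / 2) : k)⁻¹ = 1 by simp, map_one, one_mul]
    exact Dan.toLau_coord _ 1

lemma range_toLau_le : (toLau lam).range ≤ M (quad lam) := by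
  rw [← Dan.range_toLau]
  rintro _ ⟨a, rfl⟩
  exact ⟨_, rfl⟩

end Slam

namespace Qlam

open Slam

lemma eq_adjoin : Qlam k lam = Algebra.adjoin k {Slam.coord lam 2 ^ 2,
    Slam.coord lam 1 * Slam.coord lam 2,
    3 * Slam.coord lam 0 * Slam.coord lam 2 - algebraMap k _ lam,
    Slam.coord lam 0 * Slam.coord lam 1, Slam.coord lam 0 ^ 2} := rfl

lemma neg_eq_self {a : Slam k lam} (ha : a ∈ Qlam k lam) : Slam.neg lam a = a := by
  have : Qlam k lam ≤ AlgHom.equalizer (Slam.neg lam) (AlgHom.id k _) := by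
    rw [eq_adjoin]
    refine Algebra.adjoin_le ?_
    rintro _ (rfl | rfl | rfl | rfl | rfl) <;>
      simp only [SetLike.mem_coe, AlgHom.mem_equalizer, map_mul, map_pow, map_sub, map_ofNat,
        Slam.neg_coord, AlgHom.commutes, AlgHom.coe_id, id] <;> ring
  exact this ha

lemma y_X_mul_x : y (Polynomial.X : Polynomial k) * x = z := by
  rw [mono_mul_mono]; simp

variable [CharZero k]

/-- The embedding of `Q_λ(k)` into `k[z][x, x⁻¹]`. -/
noncomputable def toLau : ↥(Qlam k lam) →ₐ[k] Lau k := (Slam.toLau lam).comp (Qlam k lam).val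

lemma toLau_injective : Function.Injective (toLau lam) :=
  (Slam.toLau_injective lam).comp Subtype.val_injective

lemma range_toLau : (toLau lam).range = Algebra.adjoin k {y (quad lam) ^ 2, z * y (quad lam),
    3 * x * y (quad lam) - algebraMap k _ lam, x * z, x ^ 2} := by
  rw [toLau, AlgHom.range_comp, Subalgebra.range_val, eq_adjoin, AlgHom.map_adjoin]
  simp only [Set.image_insert_eq, Set.image_singleton, map_mul, map_pow, map_sub, map_ofNat,
    AlgHom.commutes, Slam.toLau_coord]
  rfl

lemma x_mul_y_quad : 2 * x * y (quad lam) = z ^ 2 + algebraMap k (Lau k) lam := by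
  have h := congrArg (Slam.toLau lam) (Slam.coord_rel lam)
  simp only [map_sub, map_mul, map_pow, map_ofNat, AlgHom.commutes, Slam.toLau_coord] at h
  exact sub_eq_iff_eq_add'.1 h

/-- A derivation acting on a triple generating `S_λ(k)` as a lowering operator restricts to a
locally nilpotent derivation of `Q_λ(k)`. -/
lemma exists_lowering {v₀ v₁ v₂ : Lau k} {E : Derivation k (Lau k) (Lau k)} (h₀ : E v₀ = 0)
    (h₁ : E v₁ = v₀) (h₂ : E v₂ = v₁) (hrel : 2 * v₀ * v₂ = v₁ ^ 2 + algebraMap k (Lau k) lam)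
    (hM : M (quad lam) ≤ Algebra.adjoin k {v₀, v₁, v₂})
    (hr : (toLau lam).range = Algebra.adjoin k {v₂ ^ 2, v₁ * v₂,
      3 * v₀ * v₂ - algebraMap k _ lam, v₀ * v₁, v₀ ^ 2}) :
    ∃ D : Derivation k (Qlam k lam) (Qlam k lam), IsLND D ∧
      ∀ a, toLau lam (D a) = E (toLau lam a) := by
  have hst (a : Qlam k lam) : E (toLau lam a) ∈ (toLau lam).range := by
    have ha : toLau lam a ∈ (toLau lam).range := ⟨a, rfl⟩
    rw [hr] at ha ⊢
    refine Derivation.mem_of_mem_adjoin _ _ _ Algebra.subset_adjoin ?_ ha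
    have h3 : E (3 : Lau k) = 0 := by exact_mod_cast E.map_natCast 3
    rintro _ (rfl | rfl | rfl | rfl | rfl)
    · have : E (v₂ ^ 2) = v₁ * v₂ + v₁ * v₂ := by
        rw [pow_two, Derivation.leibniz, h₂, smul_eq_mul, mul_comm]
      rw [this]
      exact add_mem (Algebra.subset_adjoin (by simp)) (Algebra.subset_adjoin (by simp))
    · have : E (v₁ * v₂) = 3 * v₀ * v₂ - algebraMap k _ lam := by
        rw [Derivation.leibniz, h₁, h₂, smul_eq_mul, smul_eq_mul]
        linear_combination -hrel
      rw [this]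
      exact Algebra.subset_adjoin (by simp)
    · have : E (3 * v₀ * v₂ - algebraMap k _ lam) = v₀ * v₁ + v₀ * v₁ + v₀ * v₁ := by
        rw [map_sub, Derivation.map_algebraMap, Derivation.leibniz, Derivation.leibniz, h₀, h₂, h3]
        simp only [smul_eq_mul]
        ring
      rw [this]
      refine add_mem (add_mem ?_ ?_) ?_ <;> exact Algebra.subset_adjoin (by simp)
    · have : E (v₀ * v₁) = v₀ ^ 2 := by
        rw [Derivation.leibniz, h₀, h₁, smul_zero, add_zero, smul_eq_mul, pow_two]
      rw [this]
      exact Algebra.subset_adjoin (by simp)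
    · have : E (v₀ ^ 2) = 0 := by
        rw [pow_two, Derivation.leibniz, h₀, smul_zero, add_zero]
      rw [this]
      exact zero_mem _
  obtain ⟨D, hD⟩ := Derivation.exists_restrict (toLau_injective lam) _ hst
  refine ⟨D, IsLND.of_restrict (toLau_injective lam) hD ?_, hD⟩
  have : (toLau lam).range ≤ (Slam.toLau lam).range := AlgHom.range_comp_le_range _ _
  refine ((this.trans (range_toLau_le lam)).trans hM).trans (Algebra.adjoin_le ?_)
  rintro _ (rfl | rfl | rfl)
  exacts [⟨1, h₀⟩, ⟨2, by simp [h₀, h₁]⟩, ⟨3, by simp [h₀, h₁, h₂]⟩]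

lemma exists_down : ∃ D : Derivation k (Qlam k lam) (Qlam k lam), IsLND D ∧
    ∀ a, toLau lam (D a) = br (-x) (toLau lam a) := by
  refine exists_lowering lam (v₀ := x) (v₁ := z) (v₂ := y (quad lam)) (E := ad (-x)) ?_ ?_ ?_
    (x_mul_y_quad lam) ?_ ?_
  · simp [ad_apply, br, dz_x]
  · simp [ad_apply, br, dz_x, dz_z, th_x, th_z]
  · rw [ad_apply, br, map_neg, map_neg, dz_x, th_x, dz_y, derivative_quad]
    linear_combination y_X_mul_x (k := k)
  · rw [M_eq_adjoin]
    exact Algebra.adjoin_mono (by grind)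
  · rw [range_toLau]

lemma exists_up : ∃ U : Derivation k (Qlam k lam) (Qlam k lam), IsLND U ∧
    ∀ a, toLau lam (U a) = br (y (quad lam)) (toLau lam a) := by
  refine exists_lowering lam (v₀ := y (quad lam)) (v₁ := z) (v₂ := x) (E := ad (y (quad lam)))
    (br_self _) ?_ ?_ ?_ ?_ ?_
  · simp [ad_apply, br, th_y, dz_z, th_z]
  · rw [ad_apply, br, dz_x, th_x, dz_y, derivative_quad]
    linear_combination y_X_mul_x (k := k)
  · linear_combination x_mul_y_quad lam
  · rw [M_eq_adjoin]
    exact Algebra.adjoin_mono (by grind)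
  · rw [range_toLau]
    congr 1
    rw [mul_assoc, mul_comm x (y _), ← mul_assoc, mul_comm x z, mul_comm z (y _)]
    grind

theorem not_equiv_dan {psi : Polynomial k} (hpsi : 1 ≤ psi.natDegree) :
    ¬ Nonempty (Qlam k lam ≃ₐ[k] Dan k psi) := by
  rintro ⟨e⟩
  obtain ⟨D, hD, hD'⟩ := exists_down lam
  obtain ⟨U, hU, hU'⟩ := exists_up lam
  have hi := toLau_injective lam
  have hpsi0 : psi ≠ 0 := by rintro rfl; simp at hpsi
  set J : Qlam k lam →ₐ[k] Lau k := (Dan.toLau psi).comp e.toAlgHom with hJ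
  have hj : Function.Injective J := (Dan.toLau_injective hpsi0).comp e.injective
  have hr : J.range = M psi := by
    rw [← Dan.range_toLau]
    refine le_antisymm (AlgHom.range_comp_le_range _ _) ?_
    rintro _ ⟨b, rfl⟩
    exact ⟨e.symm b, congrArg (Dan.toLau psi) (e.apply_symm_apply b)⟩
  obtain ⟨h, hh⟩ := hD.exists_hamiltonian hpsi hj hr
  obtain ⟨g, hg⟩ := hU.exists_hamiltonian hpsi hj hr
  have hE (c : Qlam k lam) : toLau lam (⁅D, U⁆ c) = th (toLau lam c) := by
    have : br (-x) (y (quad lam)) = z := by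
      rw [br, map_neg, map_neg, dz_x, th_x, dz_y, derivative_quad]
      linear_combination y_X_mul_x (k := k)
    rw [Derivation.commutator_apply, map_sub, hD', hU', hU', hD', br_jacobi, this, br_z]
  have hEJ (c : Qlam k lam) : J (⁅D, U⁆ c) = br (br (J h) (J g)) (J c) := by
    rw [Derivation.commutator_apply, map_sub, hh, hg, hg, hh, br_jacobi]
  have hED (c : Qlam k lam) : ⁅D, U⁆ (D c) - D (⁅D, U⁆ c) = D c := by
    apply hi
    rw [map_sub, hE, hD', hD', hE]
    simp only [br, map_neg, map_sub, Derivation.leibniz, dz_x, th_x, smul_eq_mul, dz_th,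
      map_zero]
    ring
  obtain ⟨c₀, hc₀⟩ : ∃ c, br (br (J h) (J g)) (J h) - J h = algebraMap k (Lau k) c := by
    refine const_of_br_eq_zero hr fun c => ?_
    have := congrArg J (hED c)
    rw [map_sub, hEJ, hh, hh, hEJ, br_jacobi] at this
    have hsub (a b d : Lau k) : br (a - b) d = br a d - br b d := by
      simp only [br, map_sub]; ring
    rw [hsub, this, sub_self]
  rw [← hEJ, ← map_sub, ← J.commutes] at hc₀
  replace hc₀ := hj hc₀
  set h' := h + algebraMap k _ c₀ with hh'
  have hE' : ⁅D, U⁆ h' = h' := by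
    rw [hh', map_add, Derivation.map_algebraMap, ← hc₀]
    ring
  have hD0 : D h' = 0 := by
    rw [hh', map_add, Derivation.map_algebraMap, add_zero]
    apply hj
    rw [hh, br_self, map_zero]
  have hth : th (toLau lam h') = toLau lam h' := by rw [← hE, hE']
  have hdz : dz (toLau lam h') = 0 := by
    have := hD' h'
    rw [hD0, map_zero, br, map_neg, map_neg, dz_x, th_x] at this
    exact (mul_eq_zero.1 (show x * dz (toLau lam h') = 0 by linear_combination -this)).resolve_left
      x_ne_zero
  obtain ⟨α, hα⟩ : ∃ α, xinv * toLau lam h' = algebraMap k (Lau k) α := by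
    refine eq_const_of_casimir ?_ ?_
    · rw [Derivation.leibniz, hdz, dz_mono]; simp [mono_zero]
    · have : th (xinv : Lau k) = -xinv := by simp [th_mono, mono_neg]
      rw [Derivation.leibniz, hth, this, smul_eq_mul, smul_eq_mul]; ring
  have hα' : Slam.toLau lam h' = Slam.toLau lam (algebraMap k _ α * coord lam 0) := by
    rw [map_mul, AlgHom.commutes, Slam.toLau_coord]
    change toLau lam h' = _ * x
    rw [← hα]
    linear_combination -toLau lam h' * xinv_mul_x (k := k)
  replace hα' := Slam.toLau_injective lam hα'
  have hneg := neg_eq_self lam h'.2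
  rw [hα', map_mul, AlgHom.commutes, neg_coord] at hneg
  have h0 : h' = 0 := by
    apply Subtype.ext
    rw [hα']
    have h2 : (2 : k) • (algebraMap k (Slam k lam) α * coord lam 0) = 0 := by
      rw [ofNat_smul_eq_nsmul, two_nsmul]
      linear_combination -hneg
    exact (smul_eq_zero_iff_right two_ne_zero).1 h2
  have hDz (c : Qlam k lam) : D c = 0 := by
    apply hj
    rw [hh, eq_sub_of_add_eq (hh'.symm.trans h0), zero_sub, map_neg, AlgHom.commutes, br, map_neg,
      map_neg, Derivation.map_algebraMap, Derivation.map_algebraMap]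
    simp
  have hxz : x * z ∈ (toLau lam).range := by
    rw [range_toLau]
    exact Algebra.subset_adjoin (by simp)
  obtain ⟨c, hc⟩ := hxz
  replace hc : toLau lam c = x * z := hc
  have := hD' c
  rw [hDz, hc, map_zero, br_mul_right, br] at this
  simp only [br, map_neg, dz_x, dz_z, th_x, th_z] at this
  refine mul_ne_zero x_ne_zero x_ne_zero (?_ : (x * x : Lau k) = 0)
  linear_combination -this

end Qlam

end Quotient

/-- if the special Danielewski surface ring `B = k[X,Y,Z]/(XY − φ(Z))`,
`deg φ ≥ 2`, admits a nontrivial fundamental pair, then `deg φ = 2` and `B` is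
isomorphic to `k[F_2]` or to some `S_λ(k)`, `λ ∈ k*`; moreover no `Q_λ(k)` (`λ ∈ k*`)
is isomorphic to a special Danielewski surface ring `k[X,Y,Z]/(XY − ψ(Z))`,
`ψ` nonconstant. -/
theorem stmt_16 {k : Type*} [Field k] [CharZero k]
    (phi : Polynomial k) (hphi : 2 ≤ phi.natDegree)
    (D U : Derivation k (Dan k phi) (Dan k phi))
    (hDU : IsFundamentalPair D U) (hnt : ¬(D = 0 ∧ U = 0)) :
    (phi.natDegree = 2 ∧
      (Nonempty (Dan k phi ≃ₐ[k] ↥(coneRNC2 k)) ∨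
       ∃ lam : k, lam ≠ 0 ∧ Nonempty (Dan k phi ≃ₐ[k] Slam k lam))) ∧
    (∀ lam : k, lam ≠ 0 → ∀ psi : Polynomial k, 1 ≤ psi.natDegree →
      ¬ Nonempty (↥(Qlam k lam) ≃ₐ[k] Dan k psi)) := by
  have hphi0 : phi ≠ 0 := by rintro rfl; simp at hphi
  have hdeg : phi.natDegree = 2 := le_antisymm (hDU.natDegree_le_two (by omega)
    (Dan.toLau_injective hphi0) (Dan.range_toLau phi) hnt) hphi
  exact ⟨⟨hdeg, Dan.equiv_of_natDegree_eq_two hdeg⟩,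
    fun lam _ psi hpsi => Qlam.not_equiv_dan lam hpsi⟩
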